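/- arXiv:2504.14623 — 5 statements merged into one kernel-verified Lean document; each statement's English description precedes it below -/
import Mathlib

section
/- Let t be a trace and X ⊆ P. Then the Foata normal form of the joint view is the stepwise union of the Foata normal forms of the individual views: for every index i, Foata(view_X(t))_i = ∪_{p ∈ X} Foata(view_p(t))_i. -/
variable {α P : Type*}

/-- One swap of two adjacent independent letters. -/
def SwapAdj [DecidableEq P] (loc : α → Finset P) (w w' : List α) : Prop :=
  ∃ (u v : List α) (a b : α), loc a ∩ loc b = ∅ ∧
    w = u ++ a :: b :: v ∧ w' = u ++ b :: a :: v

/-- Trace equivalence: finitely many swaps of adjacent independent letters. -/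
def TraceEquiv [DecidableEq P] (loc : α → Finset P) : List α → List α → Prop :=
  Relation.ReflTransGen (SwapAdj loc)

/-- Helper (on the reversed word) computing the view of a set of processes:
scanning from the right, keep an event iff its location meets the set of
processes already known to be causally after it. -/
def viewRev [DecidableEq P] (loc : α → Finset P) : Finset P → List α → List α
  | _, [] => []
  | T, a :: w =>
    if (loc a ∩ T).Nonempty then a :: viewRev loc (T ∪ loc a) w
    else viewRev loc T w

/-- The view of a set `X` of processes in the trace of `w`, as a linearisation. -/
def viewWord [DecidableEq P] (loc : α → Finset P) (X : Finset P) (w : List α) : List α :=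
  (viewRev loc X w.reverse).reverse

/-- Insertion of a letter in a (reversed) Foata normal form:
the letter is placed in the step just after the last step containing a letter
dependent on it (in a fresh last step, resp. the first step, if this is the
last step, resp. if there is no such step). -/
def foataInsRev [DecidableEq α] [DecidableEq P] (loc : α → Finset P)
    (φ : List (Finset α)) (a : α) : List (Finset α) :=
  match φ.findIdx? (fun S => decide (∃ b ∈ S, (loc a ∩ loc b).Nonempty)) with
  | some 0 => {a} :: φ
  | some (i + 1) => φ.set i (insert a (φ.getD i ∅))
  | none =>
      if φ.isEmpty then [{a}]
      else φ.set (φ.length - 1) (insert a (φ.getD (φ.length - 1) ∅))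

/-- The Foata normal form of (the trace of) a word, as its list of steps;
`(foata loc w).getD i ∅` is the `i`-th step (0-based, `∅` beyond the length). -/
def foata [DecidableEq α] [DecidableEq P] (loc : α → Finset P) (w : List α) :
    List (Finset α) :=
  (w.foldl (foataInsRev loc) []).reverse

def hRev [DecidableEq P] (loc : α → Finset P) : List α → P → ℕ
  | [], _ => 0
  | a :: r, p => if p ∈ loc a then (loc a).sup (hRev loc r) + 1 else hRev loc r p

def mRev [DecidableEq P] (loc : α → Finset P) : List α → ℕ → α → Prop
  | [], _, _ => False
  | a :: r, i, b => mRev loc r i b ∨ (b = a ∧ i = (loc a).sup (hRev loc r))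

theorem hRev_view [DecidableEq P] (loc : α → Finset P) (r : List α) (T : Finset P) (p : P)
    (hp : p ∈ T) : hRev loc (viewRev loc T r) p = hRev loc r p := by
  induction r generalizing T p with
  | nil => rfl
  | cons a r ih =>
    unfold viewRev
    split_ifs with h
    · simp only [hRev]
      split_ifs with h2
      · congr 1
        apply Finset.sup_congr rfl
        intro q hq
        exact ih _ _ (by simp [hq])
      · exact ih _ _ (by simp [hp])
    · have : p ∉ loc a := fun h2 => h ⟨p, by simp [h2, hp]⟩
      simp only [hRev, this, if_false]
      exact ih _ _ hp

theorem mRev_view_cons [DecidableEq P] (loc : α → Finset P) (r : List α) (T : Finset P)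
    (a : α) (i : ℕ) (b : α) :
    mRev loc (viewRev loc T (a :: r)) i b ↔
      mRev loc (viewRev loc (if (loc a ∩ T).Nonempty then T ∪ loc a else T) r) i b ∨
      ((loc a ∩ T).Nonempty ∧ b = a ∧ i = (loc a).sup (hRev loc r)) := by
  rw [viewRev]
  split_ifs with h
  · simp only [mRev, h, true_and]
    rw [Finset.sup_congr rfl (fun q hq => hRev_view loc r (T ∪ loc a) q (by simp [hq]))]
  · simp [h]

theorem mRev_view_union [DecidableEq P] (loc : α → Finset P) (r : List α) (X Y : Finset P)
    (i : ℕ) (b : α) :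
    mRev loc (viewRev loc (X ∪ Y) r) i b ↔
      mRev loc (viewRev loc X r) i b ∨ mRev loc (viewRev loc Y r) i b := by
  induction r generalizing X Y with
  | nil => simp [viewRev, mRev]
  | cons a r ih =>
    simp only [mRev_view_cons]
    have e : (loc a ∩ (X ∪ Y)).Nonempty ↔ (loc a ∩ X).Nonempty ∨ (loc a ∩ Y).Nonempty := by
      rw [Finset.inter_union_distrib_left, Finset.union_nonempty]
    by_cases hX : (loc a ∩ X).Nonempty <;> by_cases hY : (loc a ∩ Y).Nonempty <;>
      simp only [e, hX, hY, if_true, if_false, ih, or_true, true_or, or_self,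
        true_and, false_and, or_false] <;> tauto

theorem viewRev_empty [DecidableEq P] (loc : α → Finset P) (r : List α) :
    viewRev loc ∅ r = [] := by
  induction r with
  | nil => rfl
  | cons a r ih => simp [viewRev, ih]

theorem mRev_view [DecidableEq P] (loc : α → Finset P) (r : List α) (X : Finset P)
    (i : ℕ) (b : α) :
    mRev loc (viewRev loc X r) i b ↔ ∃ p ∈ X, mRev loc (viewRev loc {p} r) i b := by
  induction X using Finset.induction_on with
  | empty => simp [viewRev_empty, mRev]
  | insert p X _ ih =>
    rw [Finset.insert_eq, mRev_view_union, ih]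
    simp

theorem hRev_le [DecidableEq P] (loc : α → Finset P) (r : List α) (p : P) (m : ℕ) :
    hRev loc r p ≤ m ↔ ∀ k b, mRev loc r k b → p ∈ loc b → k < m := by
  induction r with
  | nil => simp [hRev, mRev]
  | cons a r ih =>
    simp only [hRev, mRev]
    split_ifs with h
    · constructor
      · rintro h1 k b (h2 | ⟨rfl, rfl⟩) h3
        · refine ih.1 ?_ k b h2 h3
          have := Finset.le_sup (f := hRev loc r) h
          omega
        · omega
      · intro H
        exact H _ a (Or.inr ⟨rfl, rfl⟩) h
    · rw [ih]
      constructor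
      · rintro H k b (h2 | ⟨rfl, rfl⟩) h3
        · exact H k b h2 h3
        · exact absurd h3 h
      · intro H k b h2 h3
        exact H k b (Or.inl h2) h3

theorem lev_le [DecidableEq P] (loc : α → Finset P) (r : List α) (a : α) (m : ℕ) :
    (loc a).sup (hRev loc r) ≤ m ↔
      ∀ k b, mRev loc r k b → (loc a ∩ loc b).Nonempty → k < m := by
  simp only [Finset.sup_le_iff, hRev_le]
  constructor
  · rintro H k b h ⟨p, hp⟩
    rw [Finset.mem_inter] at hp
    exact H p hp.1 k b h hp.2
  · intro H p hp k b h h2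
    exact H k b h ⟨p, by simp [hp, h2]⟩

theorem getD_rev_cons (S : Finset α) (φ : List (Finset α)) (k : ℕ) :
    (S :: φ).reverse.getD k ∅ = if k = φ.length then S else φ.reverse.getD k ∅ := by
  rw [List.reverse_cons]
  split_ifs with h
  · subst h
    simp [List.getD_eq_getElem?_getD]
  · simp only [List.getD_eq_getElem?_getD]
    rcases lt_or_gt_of_ne h with h | h
    · rw [List.getElem?_append_left (by simpa using h)]
    · rw [List.getElem?_eq_none (by simp; omega), List.getElem?_eq_none (by simp; omega)]

theorem mem_getD_rev_lt (φ : List (Finset α)) (k : ℕ) (b : α)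
    (h : b ∈ φ.reverse.getD k ∅) : k < φ.length := by
  by_contra h2
  rw [List.getD_eq_getElem?_getD, List.getElem?_eq_none (by simp; omega)] at h
  simp at h

theorem findIdx_le (D : α → Prop) [DecidablePred D] (φ : List (Finset α)) (m : ℕ) :
    φ.length - φ.findIdx (fun S => decide (∃ b ∈ S, D b)) ≤ m ↔
      m ≥ φ.length ∨ ∀ k b, b ∈ φ.reverse.getD k ∅ → D b → k < m := by
  induction φ with
  | nil => simp
  | cons S φ ih =>
    rw [List.findIdx_cons]
    by_cases hS : ∃ b ∈ S, D b
    · simp only [hS, decide_true, cond_true, List.length_cons]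
      constructor
      · intro h; left; omega
      · rintro (h | h)
        · omega
        · obtain ⟨b, hb, hD⟩ := hS
          have := h φ.length b (by rw [getD_rev_cons]; simpa using hb) hD
          omega
    · simp only [hS, decide_false, cond_false, List.length_cons, Nat.add_sub_add_right]
      rw [ih]
      constructor
      · rintro h
        right
        intro k b hb hD
        rw [getD_rev_cons] at hb
        split_ifs at hb with hk
        · exact absurd ⟨b, hb, hD⟩ hS
        · rcases h with h | h
          · have := mem_getD_rev_lt _ _ _ hb; omega
          · exact h k b hb hD
      · rintro (h | h)
        · left; omega
        · right
          intro k b hb hD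
          have := mem_getD_rev_lt _ _ _ hb
          exact h k b (by rw [getD_rev_cons, if_neg (by omega)]; exact hb) hD

theorem findIdx_le' (D : α → Prop) [DecidablePred D] (φ : List (Finset α)) (m : ℕ) :
    φ.length - φ.findIdx (fun S => decide (∃ b ∈ S, D b)) ≤ m ↔
      ∀ k b, b ∈ φ.reverse.getD k ∅ → D b → k < m := by
  rw [findIdx_le]
  constructor
  · rintro (h | h) k b hb hD
    · have := mem_getD_rev_lt _ _ _ hb; omega
    · exact h k b hb hD
  · exact Or.inr

theorem mem_set_rev [DecidableEq α] (φ : List (Finset α)) (j : ℕ) (hj : j < φ.length) (a b : α)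
    (k : ℕ) :
    b ∈ (φ.set j (insert a (φ.getD j ∅))).reverse.getD k ∅ ↔
      b ∈ φ.reverse.getD k ∅ ∨ (b = a ∧ k = φ.length - 1 - j) := by
  induction φ generalizing j with
  | nil => simp at hj
  | cons S φ ih =>
    cases j with
    | zero =>
      simp only [List.set_cons_zero, getD_rev_cons, List.getD_cons_zero, List.length_cons]
      split_ifs with h
      · simp [h]; tauto
      · have : ¬ k = φ.length + 1 - 1 - 0 := by omega
        simp [h]
    | succ j =>
      simp only [List.length_cons] at hj
      simp only [List.set_cons_succ, getD_rev_cons, List.getD_cons_succ, List.length_cons,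
        List.length_set]
      split_ifs with h
      · have : ¬ k = φ.length + 1 - 1 - (j + 1) := by omega
        simp only [this, and_false, or_false]
      · rw [ih j (by omega)]
        have : φ.length + 1 - 1 - (j + 1) = φ.length - 1 - j := by omega
        rw [this]

theorem mem_ins [DecidableEq α] [DecidableEq P] (loc : α → Finset P)
    (φ : List (Finset α)) (a b : α) (k : ℕ) :
    b ∈ (foataInsRev loc φ a).reverse.getD k ∅ ↔
      b ∈ φ.reverse.getD k ∅ ∨ (b = a ∧ k = φ.length -
        φ.findIdx (fun S => decide (∃ b ∈ S, (loc a ∩ loc b).Nonempty))) := by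
  unfold foataInsRev
  generalize (fun S : Finset α => decide (∃ b ∈ S, (loc a ∩ loc b).Nonempty)) = f
  split
  · rename_i h
    obtain ⟨h1, h2⟩ := List.findIdx?_eq_some_iff_findIdx_eq.1 h
    rw [h2, getD_rev_cons]
    split_ifs with hk
    · subst hk
      have : b ∉ φ.reverse.getD φ.length ∅ := fun hb =>
        absurd (mem_getD_rev_lt _ _ _ hb) (lt_irrefl _)
      simp only [this, Finset.mem_singleton, false_or, Nat.sub_zero, and_true]
    · simp [hk]
  · rename_i i h
    obtain ⟨h1, h2⟩ := List.findIdx?_eq_some_iff_findIdx_eq.1 h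
    rw [h2, mem_set_rev _ _ (by omega)]
    have : φ.length - 1 - i = φ.length - (i + 1) := by omega
    rw [this]
  · rename_i h
    have h2 : φ.findIdx f = φ.length := by
      rw [List.findIdx_eq_length]
      simpa using h
    rw [h2]
    cases φ with
    | nil => cases k <;> simp
    | cons S φ =>
      rw [if_neg (by simp), mem_set_rev _ _ (by simp)]
      simp

theorem mem_foata [DecidableEq α] [DecidableEq P] (loc : α → Finset P)
    (r : List α) (k : ℕ) (b : α) :
    b ∈ (foata loc r.reverse).getD k ∅ ↔ mRev loc r k b := by
  unfold foata
  induction r generalizing k b with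
  | nil => simp [mRev]
  | cons a r ih =>
    rw [List.reverse_cons, List.foldl_append, List.foldl_cons, List.foldl_nil, mem_ins, ih, mRev]
    have : ∀ x y : ℕ, (∀ m, x ≤ m ↔ y ≤ m) → x = y := fun x y h =>
      le_antisymm ((h y).2 le_rfl) ((h x).1 le_rfl)
    refine or_congr Iff.rfl (and_congr Iff.rfl ?_)
    refine Eq.congr_right (this _ _ ?_)
    intro m
    rw [lev_le, findIdx_le']
    simp only [ih]

/-- The Foata normal form of the joint view of a set `X` of
processes is the stepwise union of the Foata normal forms of the individual
views. -/
theorem foata_view_biUnion [DecidableEq α] [DecidableEq P]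
    [Fintype α] [Fintype P]
    (loc : α → Finset P) (hloc : ∀ a, (loc a).Nonempty)
    (w : List α) (X : Finset P) (i : ℕ) :
    (foata loc (viewWord loc X w)).getD i ∅ =
      X.biUnion (fun p => (foata loc (viewWord loc {p} w)).getD i ∅) := by
  ext b
  simp only [Finset.mem_biUnion, viewWord, mem_foata]
  exact mRev_view loc w.reverse X i b
end

section
/- Let k ≥ 1 and let t be a k-fair trace. Then for every process p ∈ P, |view_p(t)| ≤ |t| ≤ |view_p(t)| + k − 1. -/
variable {α P : Type*}

/-- The set of processes participating in a word. -/
def locWord [DecidableEq P] (loc : α → Finset P) (w : List α) : Finset P :=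
  w.foldr (fun a s => loc a ∪ s) ∅

/-- The trace of `w` is `k`-fair: every factor of length at least `k` of every
linearisation involves all processes. -/
def IsFairTrace [DecidableEq P] [Fintype P] (loc : α → Finset P) (k : ℕ)
    (w : List α) : Prop :=
  ∀ w' u v x, TraceEquiv loc w w' → w' = u ++ v ++ x → k ≤ v.length →
    locWord loc v = Finset.univ

theorem TE_append [DecidableEq P] (loc : α → Finset P) {w w' : List α}
    (h : TraceEquiv loc w w') (z : List α) : TraceEquiv loc (w ++ z) (w' ++ z) := by
  induction h with
  | refl => exact Relation.ReflTransGen.refl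
  | tail _ h2 ih =>
    obtain ⟨u, v, a, b, hab, rfl, rfl⟩ := h2
    exact Relation.ReflTransGen.tail ih ⟨u, v ++ z, a, b, hab, by simp, by simp⟩

theorem TE_length [DecidableEq P] (loc : α → Finset P) {w w' : List α}
    (h : TraceEquiv loc w w') : w.length = w'.length := by
  induction h with
  | refl => rfl
  | tail _ h2 ih =>
    obtain ⟨u, v, a, b, hab, rfl, rfl⟩ := h2
    simpa using ih

theorem TE_move [DecidableEq P] (loc : α → Finset P) (a : α) (y : List α) :
    ∀ v : List α, (∀ b ∈ y, loc b ∩ loc a = ∅) →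
      TraceEquiv loc (v ++ y ++ [a]) (v ++ [a] ++ y) := by
  induction y with
  | nil => intro v _; simpa [TraceEquiv] using Relation.ReflTransGen.refl
  | cons b y ih =>
    intro v h
    have h1 := ih (v ++ [b]) (fun c hc => h c (List.mem_cons_of_mem _ hc))
    have h1' : TraceEquiv loc (v ++ b :: y ++ [a]) (v ++ [b] ++ [a] ++ y) := by simpa using h1
    exact Relation.ReflTransGen.tail h1'
      ⟨v, y, b, a, h b List.mem_cons_self, by simp, by simp⟩

theorem view_split [DecidableEq P] (loc : α → Finset P) (r : List α) :
    ∀ T : Finset P, ∃ y, TraceEquiv loc r.reverse ((viewRev loc T r).reverse ++ y) ∧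
      ∀ b ∈ y, loc b ∩ T = ∅ := by
  induction r with
  | nil => intro T; exact ⟨[], by simpa [viewRev, TraceEquiv] using Relation.ReflTransGen.refl, by simp⟩
  | cons a r ih =>
    intro T
    by_cases h : (loc a ∩ T).Nonempty
    · obtain ⟨y, h1, h2⟩ := ih (T ∪ loc a)
      refine ⟨y, ?_, fun b hb => ?_⟩
      · have h3 := TE_append loc h1 [a]
        have h4 := TE_move loc a y (viewRev loc (T ∪ loc a) r).reverse (fun b hb => by
          have := h2 b hb
          rw [Finset.inter_union_distrib_left, Finset.union_eq_empty] at this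
          exact this.2)
        have h5 := Relation.ReflTransGen.trans h3 h4
        simpa [viewRev, h, TraceEquiv] using h5
      · have := h2 b hb
        rw [Finset.inter_union_distrib_left, Finset.union_eq_empty] at this
        exact this.1
    · obtain ⟨y, h1, h2⟩ := ih T
      refine ⟨y ++ [a], ?_, fun b hb => ?_⟩
      · have h3 := TE_append loc h1 [a]
        simpa [viewRev, h] using h3
      · rcases List.mem_append.1 hb with hb | hb
        · exact h2 b hb
        · rw [List.mem_singleton.1 hb]
          exact Finset.not_nonempty_iff_eq_empty.1 h

theorem mem_locWord [DecidableEq P] (loc : α → Finset P) (y : List α) (p : P)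
    (h : p ∈ locWord loc y) : ∃ b ∈ y, p ∈ loc b := by
  induction y with
  | nil => simp [locWord] at h
  | cons b y ih =>
    have h' : p ∈ loc b ∪ locWord loc y := h
    rcases Finset.mem_union.1 h' with h' | h'
    · exact ⟨b, by simp, h'⟩
    · obtain ⟨c, hc, hp⟩ := ih h'
      exact ⟨c, by simp [hc], hp⟩

/-- For a `k`-fair trace `t` and any process `p`,
`|view_p(t)| ≤ |t| ≤ |view_p(t)| + k - 1`. -/
theorem length_view_le_length [DecidableEq P] [Fintype α] [Fintype P]
    (loc : α → Finset P) (hloc : ∀ a, (loc a).Nonempty)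
    (k : ℕ) (hk : 1 ≤ k) (w : List α) (hfair : IsFairTrace loc k w) (p : P) :
    (viewWord loc {p} w).length ≤ w.length ∧
      w.length ≤ (viewWord loc {p} w).length + (k - 1) := by
  obtain ⟨y, h1, h2⟩ := view_split loc w.reverse {p}
  rw [List.reverse_reverse] at h1
  have hl := TE_length loc h1
  have hv : (viewWord loc {p} w).length = (viewRev loc {p} w.reverse).reverse.length := rfl
  rw [List.length_append, ← hv] at hl
  have hy : y.length < k := by
    by_contra hc
    have := hfair _ (viewRev loc {p} w.reverse).reverse y [] h1 (by simp) (by omega)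
    obtain ⟨b, hb, hp⟩ := mem_locWord loc y p (by rw [this]; exact Finset.mem_univ p)
    have h3 : p ∈ loc b ∩ {p} := by simp [hp]
    rw [h2 b hb] at h3
    simp at h3
  omega
end

section
/- Let A be a DFA over Σ satisfying the diamond property with respect to I, and let k ≥ 1. Then A is k-fair if and only if the trace language L_t(A) is k-fair. -/
variable {α P : Type*}

/-- Deterministic finite-state automaton with partial transition function. -/
structure DetAut (α Q : Type*) where
  init : Q
  step : Q → α → Option Q
  final : Set Q

/-- Extended (partial) transition function on words. -/
def DetAut.run {Q : Type*} (A : DetAut α Q) (q : Q) (w : List α) : Option Q :=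
  w.foldlM A.step q

/-- The word language accepted by the DFA. -/
def DetAut.lang {Q : Type*} (A : DetAut α Q) : Set (List α) :=
  {w | ∃ qf ∈ A.final, A.run A.init w = some qf}

/-- The diamond property of a DFA with respect to the independence relation. -/
def DetAut.Diamond {Q : Type*} [DecidableEq P] (loc : α → Finset P)
    (A : DetAut α Q) : Prop :=
  ∀ a b q q' q'', loc a ∩ loc b = ∅ →
    A.step q a = some q' → A.step q' b = some q'' →
    ∃ q''', A.step q b = some q''' ∧ A.step q''' a = some q''

def DetAut.Reachable {Q : Type*} (A : DetAut α Q) (q : Q) : Prop :=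
  ∃ w, A.run A.init w = some q

def DetAut.Coreachable {Q : Type*} (A : DetAut α Q) (q : Q) : Prop :=
  ∃ w qf, A.run q w = some qf ∧ qf ∈ A.final

/-- A DFA is `k`-fair. -/
def DetAut.KFair {Q : Type*} [DecidableEq P] [Fintype P] (loc : α → Finset P)
    (A : DetAut α Q) (k : ℕ) : Prop :=
  ∀ q, A.Reachable q → ∀ u q', k ≤ u.length → A.run q u = some q' →
    A.Coreachable q' → locWord loc u = Finset.univ

theorem DetAut.run_append_aux {Q : Type*} (A : DetAut α Q) (q : Q) (u v : List α) :
    A.run q (u ++ v) = (A.run q u).bind (fun r => A.run r v) := by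
  simp only [DetAut.run, List.foldlM_append]
  rfl

theorem DetAut.run_append_iff {Q : Type*} (A : DetAut α Q) (q r : Q) (u v : List α) :
    A.run q (u ++ v) = some r ↔ ∃ m, A.run q u = some m ∧ A.run m v = some r := by
  rw [DetAut.run_append_aux, Option.bind_eq_some_iff]

theorem DetAut.run_cons_iff {Q : Type*} (A : DetAut α Q) (q r : Q) (a : α) (v : List α) :
    A.run q (a :: v) = some r ↔ ∃ m, A.step q a = some m ∧ A.run m v = some r := by
  simp only [DetAut.run, List.foldlM_cons]
  exact Option.bind_eq_some_iff

theorem DetAut.run_equiv {Q : Type*} [DecidableEq P] (loc : α → Finset P)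
    (A : DetAut α Q) (hdiam : A.Diamond loc) (q r : Q) (w w' : List α)
    (h : TraceEquiv loc w w') (hw : A.run q w = some r) : A.run q w' = some r := by
  induction h with
  | refl => exact hw
  | tail _ hs ih =>
    obtain ⟨u, v, a, b, hab, rfl, rfl⟩ := hs
    rw [DetAut.run_append_iff] at ih ⊢
    obtain ⟨m, hm, h1⟩ := ih
    refine ⟨m, hm, ?_⟩
    rw [DetAut.run_cons_iff] at h1
    obtain ⟨m1, hm1, h2⟩ := h1
    rw [DetAut.run_cons_iff] at h2
    obtain ⟨m2, hm2, h3⟩ := h2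
    obtain ⟨m3, h4, h5⟩ := hdiam a b m m1 m2 hab hm1 hm2
    rw [DetAut.run_cons_iff]
    refine ⟨m3, h4, ?_⟩
    rw [DetAut.run_cons_iff]
    exact ⟨m2, h5, h3⟩

/-- A DFA satisfying the diamond property is `k`-fair iff its
trace language is `k`-fair. -/
theorem kfair_iff_traceLang_kfair {Q : Type*} [DecidableEq P]
    [Fintype α] [Fintype P] [Fintype Q]
    (loc : α → Finset P) (hloc : ∀ a, (loc a).Nonempty)
    (A : DetAut α Q) (hdiam : A.Diamond loc) (k : ℕ) (hk : 1 ≤ k) :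
    A.KFair loc k ↔ ∀ w ∈ A.lang, IsFairTrace loc k w := by
  constructor
  · rintro hA w ⟨qf, hqf, hrun⟩ w' u v x hequiv rfl hlen
    have h := A.run_equiv loc hdiam _ _ _ _ hequiv hrun
    rw [DetAut.run_append_iff] at h
    obtain ⟨m, hm, hx⟩ := h
    rw [DetAut.run_append_iff] at hm
    obtain ⟨m', hu, hv⟩ := hm
    exact hA m' ⟨u, hu⟩ v m hlen hv ⟨x, qf, hx, hqf⟩
  · rintro hL q ⟨u, hu⟩ v q' hlen hv ⟨x, qf, hx, hqf⟩
    refine hL (u ++ v ++ x) ⟨qf, hqf, ?_⟩ _ u v x Relation.ReflTransGen.refl rfl hlen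
    rw [DetAut.run_append_iff]
    refine ⟨q', ?_, hx⟩
    rw [DetAut.run_append_iff]
    exact ⟨q, hu, hv⟩
end

section
/- Let B ⊆ P and o ∈ B be such that every letter a with loc(a) ∩ (B ∖ {o}) ≠ ∅ satisfies loc(a) ⊆ B. Then for every trace t, view_B(t) = view_o(t)·t', where t' is the trace obtained by removing the ideal view_o(t|_{Σ^in(B)}) from view_B(t|_{Σ^in(B)}). -/
variable {α P : Type*}

def restRev [DecidableEq P] (loc : α → Finset P) : Finset P → Finset P → List α → List α
  | _, _, [] => []
  | X, Y, a :: w =>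
    if (loc a ∩ X).Nonempty then restRev loc (X ∪ loc a) (Y ∪ loc a) w
    else if (loc a ∩ Y).Nonempty then a :: restRev loc X (Y ∪ loc a) w
    else restRev loc X Y w

theorem te_append [DecidableEq P] (loc : α → Finset P) (p q : List α) {u v : List α}
    (h : TraceEquiv loc u v) : TraceEquiv loc (p ++ u ++ q) (p ++ v ++ q) := by
  induction h with
  | refl => exact Relation.ReflTransGen.refl
  | tail _ h ih =>
    refine Relation.ReflTransGen.tail ih ?_
    obtain ⟨x, y, a, b, hab, rfl, rfl⟩ := h
    exact ⟨p ++ x, y ++ q, a, b, hab, by simp, by simp⟩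

theorem te_symm [DecidableEq P] (loc : α → Finset P) {u v : List α}
    (h : TraceEquiv loc u v) : TraceEquiv loc v u := by
  induction h with
  | refl => exact Relation.ReflTransGen.refl
  | tail _ h ih =>
    refine Relation.ReflTransGen.head ?_ ih
    obtain ⟨x, y, a, b, hab, rfl, rfl⟩ := h
    exact ⟨x, y, b, a, by rw [Finset.inter_comm]; exact hab, rfl, rfl⟩

theorem te_erase [DecidableEq α] [DecidableEq P] (loc : α → Finset P) (c : α) {u v : List α}
    (h : TraceEquiv loc u v) : TraceEquiv loc (u.erase c) (v.erase c) := by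
  induction h with
  | refl => exact Relation.ReflTransGen.refl
  | tail _ h ih =>
    refine Relation.ReflTransGen.trans ih ?_
    obtain ⟨x, y, a, b, hab, rfl, rfl⟩ := h
    by_cases hx : c ∈ x
    · rw [List.erase_append_left _ hx, List.erase_append_left _ hx]
      exact Relation.ReflTransGen.single ⟨_, _, a, b, hab, rfl, rfl⟩
    · rw [List.erase_append_right _ hx, List.erase_append_right _ hx]
      by_cases hac : a = c
      · by_cases hbc : b = c
        · subst hac; subst hbc
          exact Relation.ReflTransGen.refl
        · subst hac
          simp [hbc]
          exact Relation.ReflTransGen.refl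
      · by_cases hbc : b = c
        · subst hbc
          simp [List.erase_cons, hac]
          exact Relation.ReflTransGen.refl
        · simp [List.erase_cons, hac, hbc]
          exact Relation.ReflTransGen.single ⟨_, _, a, b, hab, rfl, rfl⟩

theorem te_cancel [DecidableEq α] [DecidableEq P] (loc : α → Finset P) (x : List α)
    {u v : List α} (h : TraceEquiv loc (x ++ u) (x ++ v)) : TraceEquiv loc u v := by
  induction x with
  | nil => simpa using h
  | cons a x ih =>
    apply ih
    simpa using te_erase loc a h

theorem te_comm [DecidableEq P] (loc : α → Finset P) (a : α) (L : List α)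
    (h : ∀ b ∈ L, loc b ∩ loc a = ∅) : TraceEquiv loc (L ++ [a]) (a :: L) := by
  induction L with
  | nil => exact Relation.ReflTransGen.refl
  | cons b L ih =>
    have h1 := te_append loc [b] [] (ih fun c hc => h c (List.mem_cons_of_mem _ hc))
    simp only [List.append_nil, List.singleton_append] at h1
    exact Relation.ReflTransGen.tail h1 ⟨[], L, b, a, h b (by simp), rfl, rfl⟩

theorem restRev_indep [DecidableEq P] (loc : α → Finset P) (w : List α) :
    ∀ X Y : Finset P, ∀ b ∈ restRev loc X Y w, loc b ∩ X = ∅ := by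
  induction w with
  | nil => intro X Y b hb; simp [restRev] at hb
  | cons a w ih =>
    intro X Y b hb
    rw [restRev] at hb
    split_ifs at hb with h1 h2
    · have := ih _ _ b hb
      rw [← Finset.subset_empty] at this ⊢
      exact (Finset.inter_subset_inter_left Finset.subset_union_left).trans this
    · rcases List.mem_cons.1 hb with rfl | hb
      · exact Finset.not_nonempty_iff_eq_empty.1 h1
      · exact ih _ _ b hb
    · exact ih _ _ b hb

theorem view_split_s11 [DecidableEq P] (loc : α → Finset P) (w : List α) :
    ∀ X Y : Finset P, X ⊆ Y → TraceEquiv loc (viewRev loc Y w).reverse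
      ((viewRev loc X w).reverse ++ (restRev loc X Y w).reverse) := by
  induction w with
  | nil => intro X Y _; exact Relation.ReflTransGen.refl
  | cons a w ih =>
    intro X Y hXY
    rw [viewRev, viewRev, restRev]
    by_cases h1 : (loc a ∩ X).Nonempty
    · have h2 : (loc a ∩ Y).Nonempty := h1.mono (Finset.inter_subset_inter_left hXY)
      simp only [h1, h2, if_true, List.reverse_cons]
      have e1 := te_append loc [] [a] (ih (X ∪ loc a) (Y ∪ loc a)
        (Finset.union_subset_union_left hXY))
      have e2 := te_append loc (viewRev loc (X ∪ loc a) w).reverse []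
        (te_comm loc a (restRev loc (X ∪ loc a) (Y ∪ loc a) w).reverse (by
          intro b hb
          have := restRev_indep loc w _ _ b (List.mem_reverse.1 hb)
          rw [← Finset.subset_empty] at this ⊢
          exact (Finset.inter_subset_inter_left Finset.subset_union_right).trans this))
      simp only [List.append_nil, List.nil_append, List.append_assoc,
        List.singleton_append] at e1 e2 ⊢
      exact Relation.ReflTransGen.trans e1 e2
    · by_cases h2 : (loc a ∩ Y).Nonempty
      · simp only [h1, h2, if_true, if_false, List.reverse_cons]
        have e1 := te_append loc [] [a] (ih X (Y ∪ loc a)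
          (hXY.trans Finset.subset_union_left))
        simpa using e1
      · simp only [h1, h2, if_false]
        exact ih X Y hXY

theorem rest_filter [DecidableEq P]
    (loc : α → Finset P) (hloc : ∀ a, (loc a).Nonempty)
    (B : Finset P) (o : P)
    (hbag : ∀ a : α, (loc a ∩ B.erase o).Nonempty → loc a ⊆ B)
    (w : List α) : ∀ X Y X' Y' : Finset P, o ∈ X → (∀ p ∈ B, p ∈ X ↔ p ∈ X') →
      B ⊆ Y → Y ⊆ X ∪ B → B ⊆ Y' →
      restRev loc X Y w = restRev loc X' Y' (w.filter fun a => decide (loc a ⊆ B)) := by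
  induction w with
  | nil => intros; simp [restRev]
  | cons a w ih =>
    intro X Y X' Y' hoX hXX hBY hY hBY'
    by_cases ha : loc a ⊆ B
    · have hf : (a :: w).filter (fun a => decide (loc a ⊆ B))
          = a :: w.filter (fun a => decide (loc a ⊆ B)) := by simp [ha]
      rw [hf, restRev, restRev]
      have hY1 : (loc a ∩ Y).Nonempty := by
        rw [Finset.inter_eq_left.2 (ha.trans hBY)]; exact hloc a
      have hY2 : (loc a ∩ Y').Nonempty := by
        rw [Finset.inter_eq_left.2 (ha.trans hBY')]; exact hloc a
      have hX : loc a ∩ X = loc a ∩ X' := by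
        ext p
        simp only [Finset.mem_inter]
        exact and_congr_right fun hp => hXX p (ha hp)
      simp only [hX, hY1, hY2, if_true]
      split_ifs
      · apply ih
        · grind
        · grind
        · grind
        · grind
        · grind
      · congr 1
        apply ih
        · grind
        · grind
        · grind
        · grind
        · grind
    · have hf : (a :: w).filter (fun a => decide (loc a ⊆ B))
          = w.filter (fun a => decide (loc a ⊆ B)) := by simp [ha]
      have hn : ∀ p ∈ loc a, p ∈ B → p = o := by
        intro p hp hB
        by_contra hne
        exact ha (hbag a ⟨p, by simp [hp, hB, hne]⟩)
      rw [hf, restRev]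
      by_cases h1 : (loc a ∩ X).Nonempty
      · simp only [h1, if_true]
        apply ih
        · grind
        · grind
        · grind
        · grind
        · grind
      · have h2 : ¬ (loc a ∩ Y).Nonempty := by
          rintro ⟨p, hp⟩
          apply h1
          rw [Finset.mem_inter] at hp
          refine ⟨p, Finset.mem_inter.2 ⟨hp.1, ?_⟩⟩
          rcases Finset.mem_union.1 (hY hp.2) with h | h
          · exact h
          · rw [hn p hp.1 h]; exact hoX
        simp only [h1, h2, if_false]
        exact ih _ _ _ _ hoX hXX hBY hY hBY'

/-- For a bag `B` with outer process `o` (every letter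
involving an inner process of `B` has its location inside `B`),
`view_B(t) = view_o(t) · t'` where `t'` is the trace obtained by removing
`view_o(t|Σin(B))` from `view_B(t|Σin(B))`; i.e. any trace `t'` with
`view_B(t|Σin(B)) = view_o(t|Σin(B)) · t'` satisfies
`view_B(t) = view_o(t) · t'`. -/
theorem view_bag_decomposition [DecidableEq α] [DecidableEq P]
    [Fintype α] [Fintype P]
    (loc : α → Finset P) (hloc : ∀ a, (loc a).Nonempty)
    (B : Finset P) (o : P) (ho : o ∈ B)
    (hbag : ∀ a : α, (loc a ∩ B.erase o).Nonempty → loc a ⊆ B)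
    (w : List α) :
    ∀ t' : List α,
      TraceEquiv loc (viewWord loc B (w.filter fun a => decide (loc a ⊆ B)))
        (viewWord loc {o} (w.filter fun a => decide (loc a ⊆ B)) ++ t') →
      TraceEquiv loc (viewWord loc B w) (viewWord loc {o} w ++ t') := by
  intro t' h
  have hoB : ({o} : Finset P) ⊆ B := Finset.singleton_subset_iff.2 ho
  have s1 := view_split_s11 loc w.reverse {o} B hoB
  have s2 := view_split_s11 loc (w.filter fun a => decide (loc a ⊆ B)).reverse {o} B hoB
  have hr := rest_filter loc hloc B o hbag w.reverse {o} B {o} B (by simp) (by simp)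
    subset_rfl Finset.subset_union_right subset_rfl
  rw [List.filter_reverse] at hr
  rw [← hr] at s2
  have h3 := te_cancel loc _ (Relation.ReflTransGen.trans (te_symm loc s2) h)
  have h4 := te_append loc (viewRev loc {o} w.reverse).reverse [] h3
  simp only [List.append_nil] at h4
  exact Relation.ReflTransGen.trans s1 h4
end

section
/- Let B ⊆ P and o ∈ B be such that every letter a with loc(a) ∩ (B ∖ {o}) ≠ ∅ satisfies loc(a) ⊆ B. Then for every trace t, the following two traces are equal: (1) the trace obtained by removing the prefix view_o(t) from view_B(t); and (2) the trace obtained by removing the prefix view_o(t|_{Σ^in(B)}) from view_B(t|_{Σ^in(B)}). -/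
variable {α P : Type*}

theorem SwapAdj.symm' [DecidableEq P] {loc : α → Finset P} {w w' : List α}
    (h : SwapAdj loc w w') : SwapAdj loc w' w := by
  obtain ⟨u, v, a, b, hab, rfl, rfl⟩ := h
  exact ⟨u, v, b, a, by rw [Finset.inter_comm]; exact hab, rfl, rfl⟩

theorem TraceEquiv.symm' [DecidableEq P] {loc : α → Finset P} {w w' : List α}
    (h : TraceEquiv loc w w') : TraceEquiv loc w' w := by
  induction h with
  | refl => exact Relation.ReflTransGen.refl
  | tail _ h ih => exact Relation.ReflTransGen.head h.symm' ih

theorem TraceEquiv.trans' [DecidableEq P] {loc : α → Finset P} {w w' w'' : List α}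
    (h : TraceEquiv loc w w') (h' : TraceEquiv loc w' w'') : TraceEquiv loc w w'' :=
  Relation.ReflTransGen.trans h h'

theorem TraceEquiv.cons' [DecidableEq P] {loc : α → Finset P} {w w' : List α} (a : α)
    (h : TraceEquiv loc w w') : TraceEquiv loc (a :: w) (a :: w') := by
  refine Relation.ReflTransGen.lift (fun l => a :: l) ?_ _ _ h
  rintro _ _ ⟨u, v, x, y, hxy, rfl, rfl⟩
  exact ⟨a :: u, v, x, y, hxy, rfl, rfl⟩

theorem TraceEquiv.reverse' [DecidableEq P] {loc : α → Finset P} {w w' : List α}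
    (h : TraceEquiv loc w w') : TraceEquiv loc w.reverse w'.reverse := by
  refine Relation.ReflTransGen.lift List.reverse ?_ _ _ h
  rintro _ _ ⟨u, v, x, y, hxy, rfl, rfl⟩
  exact ⟨v.reverse, u.reverse, y, x, by rw [Finset.inter_comm]; exact hxy, by simp, by simp⟩

theorem TraceEquiv.erase' [DecidableEq α] [DecidableEq P] {loc : α → Finset P} {w w' : List α}
    (a : α) (h : TraceEquiv loc w w') : TraceEquiv loc (w.erase a) (w'.erase a) := by
  induction h with
  | refl => exact Relation.ReflTransGen.refl
  | tail _ h ih =>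
    refine ih.trans' ?_
    obtain ⟨u, v, x, y, hxy, rfl, rfl⟩ := h
    by_cases hu : a ∈ u
    · rw [List.erase_append_left _ hu, List.erase_append_left _ hu]
      exact Relation.ReflTransGen.single ⟨_, v, x, y, hxy, rfl, rfl⟩
    · rw [List.erase_append_right _ hu, List.erase_append_right _ hu]
      by_cases hx : x = a
      · subst hx
        by_cases hy : y = x
        · subst hy; exact Relation.ReflTransGen.refl
        · have : (y == x) = false := by simpa using hy
          simp only [List.erase_cons, this, beq_self_eq_true]
          exact Relation.ReflTransGen.refl
      · have hx' : (x == a) = false := by simpa using hx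
        by_cases hy : y = a
        · subst hy
          simp only [List.erase_cons, hx', beq_self_eq_true]
          exact Relation.ReflTransGen.refl
        · have hy' : (y == a) = false := by simpa using hy
          simp only [List.erase_cons, hx', hy']
          exact Relation.ReflTransGen.single ⟨u, v.erase a, x, y, hxy, rfl, rfl⟩

theorem TraceEquiv.cancel' [DecidableEq α] [DecidableEq P] {loc : α → Finset P} {s t : List α}
    (u : List α) (h : TraceEquiv loc (u ++ s) (u ++ t)) : TraceEquiv loc s t := by
  induction u with
  | nil => exact h
  | cons a u ih => exact ih (by simpa using h.erase' a)

theorem TraceEquiv.move' [DecidableEq P] {loc : α → Finset P} (a : α) (r v : List α)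
    (h : ∀ x ∈ r, loc a ∩ loc x = ∅) : TraceEquiv loc (a :: (r ++ v)) (r ++ a :: v) := by
  induction r with
  | nil => exact Relation.ReflTransGen.refl
  | cons x r ih =>
    have h1 : TraceEquiv loc (a :: (x :: r ++ v)) (x :: a :: (r ++ v)) :=
      Relation.ReflTransGen.single ⟨[], r ++ v, a, x, h x (by simp), rfl, rfl⟩
    exact h1.trans' ((ih fun y hy => h y (by simp [hy])).cons' x)

/-- Events outside the view of `T`, located in `B`, on the reversed word. -/
def remRev [DecidableEq P] (loc : α → Finset P) (B : Finset P) : Finset P → List α → List α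
  | _, [] => []
  | T, a :: w =>
    if (loc a ∩ T).Nonempty then remRev loc B (T ∪ loc a) w
    else if loc a ⊆ B then a :: remRev loc B T w else remRev loc B T w

theorem remRev_disj [DecidableEq P] (loc : α → Finset P) (B : Finset P) (w : List α) :
    ∀ T, ∀ x ∈ remRev loc B T w, T ∩ loc x = ∅ := by
  induction w with
  | nil => intro T x hx; simp [remRev] at hx
  | cons a w ih =>
    intro T x hx
    rw [remRev] at hx
    split_ifs at hx with h1 h2
    · have := ih _ x hx
      exact Finset.subset_empty.1 (this ▸ Finset.inter_subset_inter_right Finset.subset_union_left)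
    · rcases List.mem_cons.1 hx with rfl | hx
      · rw [Finset.inter_comm]; exact Finset.not_nonempty_iff_eq_empty.1 h1
      · exact ih _ x hx
    · exact ih _ x hx

theorem not_meet [DecidableEq P] (loc : α → Finset P) (B : Finset P) (o : P)
    (hbag : ∀ a : α, (loc a ∩ B.erase o).Nonempty → loc a ⊆ B) (a : α) (h : ¬ loc a ⊆ B)
    (p : P) (hp : p ∈ loc a) (hB : p ∈ B) : p = o := by
  by_contra hne
  exact h (hbag a ⟨p, by simp [hp, hB, hne]⟩)

theorem view_split_s12 [DecidableEq P] (loc : α → Finset P) (hloc : ∀ a, (loc a).Nonempty)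
    (B : Finset P) (o : P)
    (hbag : ∀ a : α, (loc a ∩ B.erase o).Nonempty → loc a ⊆ B) (w : List α) :
    ∀ T, o ∈ T → TraceEquiv loc (viewRev loc (B ∪ T) w) (remRev loc B T w ++ viewRev loc T w) := by
  induction w with
  | nil => intro T _; exact Relation.ReflTransGen.refl
  | cons a w ih =>
    intro T hT
    rw [viewRev, remRev, viewRev]
    by_cases h1 : (loc a ∩ T).Nonempty
    · have h2 : (loc a ∩ (B ∪ T)).Nonempty :=
        h1.mono (Finset.inter_subset_inter_left Finset.subset_union_right)
      rw [if_pos h1, if_pos h1, if_pos h2, Finset.union_assoc]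
      refine ((ih (T ∪ loc a) (by simp [hT])).cons' a).trans' (TraceEquiv.move' _ _ _ ?_)
      intro x hx
      have := remRev_disj loc B w _ x hx
      exact Finset.subset_empty.1 (this ▸ Finset.inter_subset_inter_right Finset.subset_union_right)
    · rw [if_neg h1, if_neg h1]
      by_cases h2 : loc a ⊆ B
      · have h3 : (loc a ∩ (B ∪ T)).Nonempty := by
          obtain ⟨p, hp⟩ := hloc a
          exact ⟨p, by simp [hp, h2 hp]⟩
        have h4 : B ∪ T ∪ loc a = B ∪ T :=
          Finset.union_eq_left.2 (h2.trans Finset.subset_union_left)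
        rw [if_pos h2, if_pos h3, h4]
        exact (ih T hT).cons' a
      · have h3 : ¬ (loc a ∩ (B ∪ T)).Nonempty := by
          rintro ⟨p, hp⟩
          rw [Finset.mem_inter, Finset.mem_union] at hp
          obtain ⟨hp, hB | hT'⟩ := hp
          · have := not_meet loc B o hbag a h2 p hp hB
            subst this
            exact h1 ⟨p, by simp [hp, hT]⟩
          · exact h1 ⟨p, by simp [hp, hT']⟩
        rw [if_neg h2, if_neg h3]
        exact ih T hT

theorem rem_filter [DecidableEq P] (loc : α → Finset P)
    (B : Finset P) (o : P)
    (hbag : ∀ a : α, (loc a ∩ B.erase o).Nonempty → loc a ⊆ B) (w : List α) :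
    ∀ T, o ∈ T → remRev loc B T w =
      remRev loc B (T ∩ B) (w.filter fun a => decide (loc a ⊆ B)) := by
  induction w with
  | nil => intro T _; rfl
  | cons a w ih =>
    intro T hT
    by_cases h2 : loc a ⊆ B
    · rw [List.filter_cons_of_pos (by simpa using h2), remRev, remRev]
      have h3 : loc a ∩ (T ∩ B) = loc a ∩ T := by
        ext p; simp only [Finset.mem_inter]
        exact ⟨fun h => ⟨h.1, h.2.1⟩, fun h => ⟨h.1, h.2, h2 h.1⟩⟩
      have h4 : (T ∪ loc a) ∩ B = T ∩ B ∪ loc a := by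
        rw [Finset.union_inter_distrib_right, Finset.inter_eq_left.2 h2]
      rw [h3, if_pos h2, if_pos h2, ih T hT, ih (T ∪ loc a) (by simp [hT]), h4]
    · rw [List.filter_cons_of_neg (by simpa using h2), remRev, if_neg h2]
      split_ifs with h1
      · rw [ih (T ∪ loc a) (by simp [hT])]
        congr 1
        ext p
        simp only [Finset.mem_inter, Finset.mem_union]
        constructor
        · rintro ⟨h | h, hB⟩
          · exact ⟨h, hB⟩
          · have := not_meet loc B o hbag a h2 p h hB
            subst this
            exact ⟨hT, hB⟩
        · rintro ⟨h, hB⟩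
          exact ⟨Or.inl h, hB⟩
      · exact ih T hT

theorem word_split [DecidableEq P] (loc : α → Finset P) (hloc : ∀ a, (loc a).Nonempty)
    (B : Finset P) (o : P) (ho : o ∈ B)
    (hbag : ∀ a : α, (loc a ∩ B.erase o).Nonempty → loc a ⊆ B) (w : List α) :
    TraceEquiv loc (viewWord loc B w)
      (viewWord loc {o} w ++ (remRev loc B {o} w.reverse).reverse) := by
  have h := (view_split_s12 loc hloc B o hbag w.reverse {o} (by simp)).reverse'
  rw [List.reverse_append, Finset.union_eq_left.2 (by simpa using ho)] at h
  exact h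

/-- For a bag `B` with outer process `o` (every letter
involving an inner process of `B` has its location inside `B`), the trace
obtained by removing the prefix `view_o(t)` from `view_B(t)` equals the trace
obtained by removing the prefix `view_o(t|Σin(B))` from `view_B(t|Σin(B))`:
any `t₁` with `view_B(t) = view_o(t)·t₁` and any `t₂` with
`view_B(t|Σin(B)) = view_o(t|Σin(B))·t₂` are equivalent. -/
theorem remove_view_eq [DecidableEq α] [DecidableEq P]
    [Fintype α] [Fintype P]
    (loc : α → Finset P) (hloc : ∀ a, (loc a).Nonempty)
    (B : Finset P) (o : P) (ho : o ∈ B)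
    (hbag : ∀ a : α, (loc a ∩ B.erase o).Nonempty → loc a ⊆ B)
    (w : List α) :
    ∀ t₁ t₂ : List α,
      TraceEquiv loc (viewWord loc B w) (viewWord loc {o} w ++ t₁) →
      TraceEquiv loc (viewWord loc B (w.filter fun a => decide (loc a ⊆ B)))
        (viewWord loc {o} (w.filter fun a => decide (loc a ⊆ B)) ++ t₂) →
      TraceEquiv loc t₁ t₂ := by
  intro t₁ t₂ h1 h2
  have k1 := ((word_split loc hloc B o ho hbag w).symm'.trans' h1).cancel'
  have k2 := ((word_split loc hloc B o ho hbag _).symm'.trans' h2).cancel'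
  have e := rem_filter loc B o hbag w.reverse {o} (by simp)
  rw [Finset.inter_eq_left.2 (by simpa using ho), List.filter_reverse] at e
  rw [← e] at k2
  exact k1.symm'.trans' k2
end
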